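/- arXiv:2412.15996 — 2 statements merged into one kernel-verified Lean document; each statement's English description precedes it below -/
import Mathlib

section
/- Let n ≥ 1, ν₀ ∈ ℝ, let h_{αβ} : ℝ^n → ℝ^{n×n} be a smooth constant-curvature metric with R^{(h)α}{}_{βγδ} = ν₀(δ^α_γ h_{δβ} − δ^α_δ h_{γβ}), let k_{αβ}(y) be a smooth symmetric 2-tensor, and let Γ be the induced Carrollian connection on ℝ × ℝ^n (Γ^α_{βγ} = Christoffels of h, Γ^u_{βγ} = ν₀(½k_{βγ} + u h_{βγ}), other components zero). Let X = ω(y)∂_u + Σ_α χ^α(y)∂_α with χ a Killing vector of h, and let (L_XΓ)^a_{bc} be the Lie derivative of the connection. Then the trace condition Σ_{β,γ} h^{βγ}(L_XΓ)^a_{βγ} = 0 for all a (Troessaert's BMS condition h^{cb}(L_X∇_c)^a{}_b = 0) is equivalent to the single scalar equation Σ_{β,γ} h^{βγ} D_βD_γ ω + n ν₀ ω = −(ν₀/2) Σ_α χ^α ∂_α k, where k := Σ_{β,γ} h^{βγ} k_{βγ} is the trace of k_{αβ}. In particular the condition only constrains the trace part of k and its preservation. -/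
open scoped BigOperators
open Filter MeasureTheory

noncomputable section

/-- Partial derivative in the `i`-th coordinate direction. -/
def pdv {m : ℕ} {F : Type*} [NormedAddCommGroup F] [NormedSpace ℝ F]
    (i : Fin m) (f : (Fin m → ℝ) → F) (x : Fin m → ℝ) : F :=
  fderiv ℝ f x (Pi.single i 1)

/-- Extension of a spatial 2-tensor on `ℝⁿ` by zero to adapted coordinates on `ℝ × ℝⁿ`. -/
def spatialExt (n : ℕ) (T : Fin n → Fin n → ℝ) (b c : Fin (n+1)) : ℝ :=
  Fin.cases (motive := fun _ => ℝ) 0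
    (fun β => Fin.cases (motive := fun _ => ℝ) 0 (fun γ => T β γ) c) b

/-- Christoffel symbols `Γ^γ_{αβ}` of a metric `h_{αβ}` on `ℝⁿ` (via the matrix inverse). -/
def ChrG (n : ℕ) (hmat : (Fin n → ℝ) → Fin n → Fin n → ℝ)
    (y : Fin n → ℝ) (γ α β : Fin n) : ℝ :=
  (1/2) * ∑ δ, (Matrix.of (hmat y))⁻¹ γ δ *
    (pdv α (fun y => hmat y δ β) y + pdv β (fun y => hmat y δ α) y
      - pdv δ (fun y => hmat y α β) y)

/-- The Riemann curvature tensor `R^α_{βγδ}` of a metric `h_{αβ}` on `ℝⁿ`. -/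
def Riem (n : ℕ) (hmat : (Fin n → ℝ) → Fin n → Fin n → ℝ)
    (y : Fin n → ℝ) (α β γ δ : Fin n) : ℝ :=
  pdv γ (fun y => ChrG n hmat y α δ β) y - pdv δ (fun y => ChrG n hmat y α γ β) y
    + ∑ ε, (ChrG n hmat y α γ ε * ChrG n hmat y ε δ β
        - ChrG n hmat y α δ ε * ChrG n hmat y ε γ β)

/-- The Carrollian connection induced on `Spi/Ti`:
`Γ^α_{βγ}` are the Christoffel symbols of `h` and `Γ^u_{βγ} = ν₀(½k_{βγ} + u h_{βγ})`. -/
def Γind (n : ℕ) (ν₀ : ℝ) (hmat kmat : (Fin n → ℝ) → Fin n → Fin n → ℝ)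
    (x : Fin (n+1) → ℝ) (a b c : Fin (n+1)) : ℝ :=
  Fin.cases (motive := fun _ => ℝ)
    (spatialExt n
      (fun β γ => ν₀ * ((1/2) * kmat (x ∘ Fin.succ) β γ + x 0 * hmat (x ∘ Fin.succ) β γ))
      b c)
    (fun α => spatialExt n (fun β γ => ChrG n hmat (x ∘ Fin.succ) α β γ) b c)
    a

/-- The vector field `X = ω(y)∂_u + χ^α(y)∂_α` on `ℝ × ℝⁿ`. -/
def XfieldTi (n : ℕ) (ω : (Fin n → ℝ) → ℝ) (χ : (Fin n → ℝ) → Fin n → ℝ)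
    (x : Fin (n+1) → ℝ) (a : Fin (n+1)) : ℝ :=
  Fin.cases (motive := fun _ => ℝ) (ω (x ∘ Fin.succ)) (fun α => χ (x ∘ Fin.succ) α) a

/-- The Lie derivative of a connection along a vector field. -/
def LieConn (n : ℕ) (Γ : (Fin (n+1) → ℝ) → Fin (n+1) → Fin (n+1) → Fin (n+1) → ℝ)
    (X : (Fin (n+1) → ℝ) → Fin (n+1) → ℝ)
    (x : Fin (n+1) → ℝ) (a b c : Fin (n+1)) : ℝ :=
  (∑ d, X x d * pdv d (fun x => Γ x a b c) x)
    - (∑ d, pdv d (fun x => X x a) x * Γ x d b c)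
    + (∑ d, Γ x a d c * pdv b (fun x => X x d) x)
    + (∑ d, Γ x a b d * pdv c (fun x => X x d) x)
    + pdv b (pdv c (fun x => X x a)) x

theorem contDiff_pdv {m : ℕ} {f : (Fin m → ℝ) → ℝ} (hf : ContDiff ℝ (⊤ : ℕ∞) f) (i : Fin m) :
    ContDiff ℝ (⊤ : ℕ∞) (fun x => pdv i f x) :=
  (hf.fderiv_right (m := (⊤ : ℕ∞)) (by simp)).clm_apply contDiff_const

theorem differentiable_of_smooth {m : ℕ} {f : (Fin m → ℝ) → ℝ}
    (hf : ContDiff ℝ (⊤ : ℕ∞) f) : Differentiable ℝ f :=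
  hf.differentiable (by simp)

theorem pdv_mul {m : ℕ} {f g : (Fin m → ℝ) → ℝ} (hf : ContDiff ℝ (⊤ : ℕ∞) f)
    (hg : ContDiff ℝ (⊤ : ℕ∞) g) (i : Fin m) (x : Fin m → ℝ) :
    pdv i (fun x => f x * g x) x = pdv i f x * g x + f x * pdv i g x := by
  unfold pdv
  rw [fderiv_fun_mul (differentiable_of_smooth hf x) (differentiable_of_smooth hg x)]
  simp
  ring

theorem pdv_add {m : ℕ} {f g : (Fin m → ℝ) → ℝ} (hf : ContDiff ℝ (⊤ : ℕ∞) f)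
    (hg : ContDiff ℝ (⊤ : ℕ∞) g) (i : Fin m) (x : Fin m → ℝ) :
    pdv i (fun x => f x + g x) x = pdv i f x + pdv i g x := by
  unfold pdv
  rw [fderiv_fun_add (differentiable_of_smooth hf x) (differentiable_of_smooth hg x)]
  simp

theorem pdv_sub {m : ℕ} {f g : (Fin m → ℝ) → ℝ} (hf : ContDiff ℝ (⊤ : ℕ∞) f)
    (hg : ContDiff ℝ (⊤ : ℕ∞) g) (i : Fin m) (x : Fin m → ℝ) :
    pdv i (fun x => f x - g x) x = pdv i f x - pdv i g x := by
  unfold pdv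
  rw [fderiv_fun_sub (differentiable_of_smooth hf x) (differentiable_of_smooth hg x)]
  simp

theorem pdv_const {m : ℕ} (c : ℝ) (i : Fin m) (x : Fin m → ℝ) :
    pdv i (fun _ => c) x = 0 := by
  simp [pdv]

theorem pdv_const_mul {m : ℕ} {f : (Fin m → ℝ) → ℝ} (c : ℝ) (hf : ContDiff ℝ (⊤ : ℕ∞) f)
    (i : Fin m) (x : Fin m → ℝ) :
    pdv i (fun x => c * f x) x = c * pdv i f x := by
  rw [pdv_mul contDiff_const hf, pdv_const]
  ring

theorem pdv_sum {m : ℕ} {ι : Type*} [Fintype ι] {f : ι → (Fin m → ℝ) → ℝ}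
    (hf : ∀ j, ContDiff ℝ (⊤ : ℕ∞) (f j)) (i : Fin m) (x : Fin m → ℝ) :
    pdv i (fun x => ∑ j, f j x) x = ∑ j, pdv i (f j) x := by
  unfold pdv
  rw [fderiv_fun_sum (fun j _ => differentiable_of_smooth (hf j) x)]
  simp

theorem pdv_comm {m : ℕ} {f : (Fin m → ℝ) → ℝ} (hf : ContDiff ℝ (⊤ : ℕ∞) f)
    (i j : Fin m) (x : Fin m → ℝ) :
    pdv i (fun x => pdv j f x) x = pdv j (fun x => pdv i f x) x := by
  have key : ∀ i j : Fin m, pdv i (fun x => pdv j f x) x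
      = fderiv ℝ (fderiv ℝ f) x (Pi.single i 1) (Pi.single j 1) := by
    intro i j
    have hd : DifferentiableAt ℝ (fderiv ℝ f) x :=
      ((hf.fderiv_right (m := (⊤ : ℕ∞)) (by simp)).differentiable (by simp)) x
    unfold pdv
    rw [fderiv_clm_apply hd (differentiableAt_const _)]
    simp
  have hs : IsSymmSndFDerivAt ℝ f x :=
    hf.contDiffAt.isSymmSndFDerivAt (by simpa using WithTop.coe_le_coe.2 (le_top (a := (2 : ℕ∞))))
  rw [key, key, hs.eq]

/-- Projection `ℝ × ℝⁿ → ℝⁿ` onto the spatial coordinates. -/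
def spatialProj (n : ℕ) : (Fin (n+1) → ℝ) →L[ℝ] (Fin n → ℝ) :=
  ContinuousLinearMap.pi fun i => ContinuousLinearMap.proj i.succ

theorem contDiff_comp_succ {n : ℕ} {f : (Fin n → ℝ) → ℝ} (hf : ContDiff ℝ (⊤ : ℕ∞) f) :
    ContDiff ℝ (⊤ : ℕ∞) (fun x : Fin (n+1) → ℝ => f (x ∘ Fin.succ)) :=
  hf.comp (spatialProj n).contDiff

theorem fderiv_comp_succ {n : ℕ} {f : (Fin n → ℝ) → ℝ} (hf : ContDiff ℝ (⊤ : ℕ∞) f)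
    (x v : Fin (n+1) → ℝ) :
    fderiv ℝ (fun x : Fin (n+1) → ℝ => f (x ∘ Fin.succ)) x v
      = fderiv ℝ f (x ∘ Fin.succ) (v ∘ Fin.succ) := by
  have h := ((differentiable_of_smooth hf (spatialProj n x)).hasFDerivAt.comp x
    (spatialProj n).hasFDerivAt).fderiv
  have h' := congrArg (fun L => L v) h
  exact h'

theorem pdv_zero_comp_succ {n : ℕ} {f : (Fin n → ℝ) → ℝ} (hf : ContDiff ℝ (⊤ : ℕ∞) f)
    (x : Fin (n+1) → ℝ) :
    pdv 0 (fun x : Fin (n+1) → ℝ => f (x ∘ Fin.succ)) x = 0 := by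
  have h0 : (Pi.single 0 1 : Fin (n+1) → ℝ) ∘ Fin.succ = 0 := by
    funext i
    simp
  unfold pdv
  rw [fderiv_comp_succ hf, h0, map_zero]

theorem pdv_succ_comp_succ {n : ℕ} {f : (Fin n → ℝ) → ℝ} (hf : ContDiff ℝ (⊤ : ℕ∞) f)
    (i : Fin n) (x : Fin (n+1) → ℝ) :
    pdv i.succ (fun x : Fin (n+1) → ℝ => f (x ∘ Fin.succ)) x = pdv i f (x ∘ Fin.succ) := by
  have h0 : (Pi.single i.succ 1 : Fin (n+1) → ℝ) ∘ Fin.succ = Pi.single i 1 := by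
    funext j
    simp [Pi.single_apply]
  unfold pdv
  rw [fderiv_comp_succ hf, h0]

theorem pdv_coord {m : ℕ} (i j : Fin m) (x : Fin m → ℝ) :
    pdv i (fun x : Fin m → ℝ => x j) x = if j = i then 1 else 0 := by
  unfold pdv
  rw [(hasFDerivAt_apply (𝕜 := ℝ) j x).fderiv]
  simp [Pi.single_apply]

theorem contDiff_matrix_det {n : ℕ} {E : Type*} [NormedAddCommGroup E] [NormedSpace ℝ E]
    {A : E → Matrix (Fin n) (Fin n) ℝ}
    (hA : ∀ i j, ContDiff ℝ (⊤ : ℕ∞) (fun y => A y i j)) :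
    ContDiff ℝ (⊤ : ℕ∞) (fun y => (A y).det) := by
  simp only [Matrix.det_apply]
  exact ContDiff.sum fun σ _ => (contDiff_prod fun i _ => hA _ _).const_smul _

theorem contDiff_matrix_inv {n : ℕ} {E : Type*} [NormedAddCommGroup E] [NormedSpace ℝ E]
    {A : E → Matrix (Fin n) (Fin n) ℝ}
    (hA : ∀ i j, ContDiff ℝ (⊤ : ℕ∞) (fun y => A y i j)) (hdet : ∀ y, IsUnit (A y).det)
    (i j : Fin n) :
    ContDiff ℝ (⊤ : ℕ∞) (fun y => (A y)⁻¹ i j) := by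
  simp only [Matrix.inv_def, Matrix.smul_apply, smul_eq_mul, Ring.inverse_eq_inv',
    Matrix.adjugate_apply]
  refine ((contDiff_matrix_det hA).inv fun y => (hdet y).ne_zero).mul
    (contDiff_matrix_det fun k l => ?_)
  by_cases hk : k = j
  · subst hk
    simpa using contDiff_const
  · simpa [Matrix.updateRow_ne hk] using hA k l

/-- The coordinate computation showing that Killing fields preserve the Levi-Civita connection:
`H`, `dH`, `ddH` are the jets of the metric, `C`, `dC`, `ddC` those of the vector field and
`Γ`, `dΓ` those of the Christoffel symbols, at a point. -/
theorem lower_lie_christoffel_eq_zero {ι : Type*} [Fintype ι]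
    (H : ι → ι → ℝ) (dH : ι → ι → ι → ℝ) (ddH : ι → ι → ι → ι → ℝ)
    (C : ι → ℝ) (dC : ι → ι → ℝ) (ddC : ι → ι → ι → ℝ)
    (Γ : ι → ι → ι → ℝ) (dΓ : ι → ι → ι → ι → ℝ)
    (Hs : ∀ a b, H a b = H b a) (dHs : ∀ m a b, dH m a b = dH m b a)
    (ddHc : ∀ m l a b, ddH m l a b = ddH l m a b)
    (ddCc : ∀ m l a, ddC m l a = ddC l m a)
    (hΓ : ∀ e a b, ∑ c, H e c * Γ c a b = 1/2 * (dH a e b + dH b e a - dH e a b))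
    (hdΓ : ∀ m e a b, ∑ c, (dH m e c * Γ c a b + H e c * dΓ m c a b)
      = 1/2 * (ddH m a e b + ddH m b e a - ddH m e a b))
    (hK : ∀ a b, ∑ c, (C c * dH c a b + H c b * dC a c + H a c * dC b c) = 0)
    (hdK : ∀ m a b, ∑ c, (dC m c * dH c a b + C c * ddH m c a b
      + (dH m c b * dC a c + H c b * ddC m a c)
      + (dH m a c * dC b c + H a c * ddC m b c)) = 0)
    (e a b : ι) :
    ∑ c, H e c * ((∑ d, C d * dΓ d c a b) - (∑ d, dC d c * Γ d a b)
      + (∑ d, Γ c d b * dC a d) + (∑ d, Γ c a d * dC b d) + ddC a b c) = 0 := by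
  have t1 : ∑ c, H e c * ∑ d, C d * dΓ d c a b
      = (∑ d, C d * (1/2 * (ddH d a e b + ddH d b e a - ddH d e a b)))
        - ∑ c, (∑ d, C d * dH d e c) * Γ c a b := by
    simp only [← hdΓ, Finset.mul_sum, Finset.sum_mul, Finset.sum_add_distrib, mul_add]
    rw [Finset.sum_comm, Finset.sum_comm (f := fun c d => C d * dH d e c * Γ c a b)]
    simp only [← Finset.sum_add_distrib, ← Finset.sum_sub_distrib]
    exact Finset.sum_congr rfl fun _ _ => Finset.sum_congr rfl fun _ _ => by ring
  have t1' : ∑ c, (∑ d, C d * dH d e c) * Γ c a b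
      = - (∑ d, dC e d * (1/2 * (dH a d b + dH b d a - dH d a b)))
        - ∑ c, H e c * ∑ d, dC d c * Γ d a b := by
    have hK' : ∀ c, ∑ d, C d * dH d e c = - ∑ d, (H d c * dC e d + H e d * dC c d) := by
      intro c
      have := hK e c
      simp only [add_assoc, Finset.sum_add_distrib] at this ⊢
      linarith
    simp only [hK', ← hΓ, Finset.mul_sum, Finset.sum_mul, neg_mul, Finset.sum_neg_distrib,
      add_mul, Finset.sum_add_distrib]
    rw [Finset.sum_comm, Finset.sum_comm (f := fun c d => H e d * dC c d * Γ c a b)]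
    rw [neg_add, sub_eq_add_neg]
    congr 2 <;>
    exact Finset.sum_congr rfl fun _ _ => Finset.sum_congr rfl fun _ _ => by ring
  have t3 : ∑ c, H e c * ∑ d, Γ c d b * dC a d
      = ∑ d, dC a d * (1/2 * (dH d e b + dH b e d - dH e d b)) := by
    simp only [← hΓ, Finset.mul_sum]
    rw [Finset.sum_comm]
    exact Finset.sum_congr rfl fun _ _ => Finset.sum_congr rfl fun _ _ => by ring
  have t4 : ∑ c, H e c * ∑ d, Γ c a d * dC b d
      = ∑ d, dC b d * (1/2 * (dH a e d + dH d e a - dH e a d)) := by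
    simp only [← hΓ, Finset.mul_sum]
    rw [Finset.sum_comm]
    exact Finset.sum_congr rfl fun _ _ => Finset.sum_congr rfl fun _ _ => by ring
  have main : ∑ d, (C d * (1/2 * (ddH d a e b + ddH d b e a - ddH d e a b))
      + dC e d * (1/2 * (dH a d b + dH b d a - dH d a b))
      + dC a d * (1/2 * (dH d e b + dH b e d - dH e d b))
      + dC b d * (1/2 * (dH a e d + dH d e a - dH e a d))
      + H e d * ddC a b d) = 0 := by
    have hsum := congrArg₂ (· - ·) (congrArg₂ (· + ·) (hdK a e b) (hdK b e a)) (hdK e a b)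
    simp only [← Finset.sum_add_distrib, ← Finset.sum_sub_distrib] at hsum
    have h2 := congrArg (fun t => 1/2 * t) hsum
    simp only [Finset.mul_sum] at h2
    refine Eq.trans (Finset.sum_congr rfl fun d _ => ?_) (h2.trans (by norm_num))
    rw [ddHc d a e b, ddHc d b e a, ddHc d e a b, ddCc b a d, ddCc e a d, ddCc e b d,
      Hs d b, Hs d a, dHs a d b, dHs b d a, dHs e d b]
    ring
  simp only [mul_add, mul_sub, Finset.sum_add_distrib, Finset.sum_sub_distrib] at main ⊢
  simp only [mul_add, mul_sub, Finset.sum_add_distrib, Finset.sum_sub_distrib] at t1 t1' t3 t4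
  linarith

theorem sum_inv_mul_of_symm {n : ℕ} {H : Matrix (Fin n) (Fin n) ℝ} (hdet : IsUnit H.det)
    (Hs : ∀ a b, H a b = H b a) : ∑ a, ∑ b, H⁻¹ a b * H a b = n := by
  have h : (H⁻¹ * H).trace = n := by
    rw [Matrix.nonsing_inv_mul _ hdet]
    simp
  rw [← h]
  simp only [Matrix.trace, Matrix.diag_apply, Matrix.mul_apply]
  exact Finset.sum_congr rfl fun a _ => Finset.sum_congr rfl fun b _ => by rw [Hs a b]

/-- Lie derivative of the inverse metric contracted with a symmetric tensor: `A a b = ∂_a χ^b`,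
`D = χ(H)` and `E = χ(H⁻¹)`. -/
theorem sum_lie_inv_mul {n : ℕ} {H D E A K : Matrix (Fin n) (Fin n) ℝ} (hdet : IsUnit H.det)
    (Hs : ∀ a b, H a b = H b a) (Ks : ∀ a b, K a b = K b a)
    (hK : D + A * H + H * A.transpose = 0) (hE : E * H + H⁻¹ * D = 0) :
    ∑ a, ∑ b, E a b * K a b
      = ∑ a, ∑ b, H⁻¹ a b * ∑ d, (K d b * A a d + K a d * A b d) := by
  have hHt : H.transpose = H := by
    ext i j
    exact Hs j i
  have hIt : H⁻¹.transpose = H⁻¹ := by rw [Matrix.transpose_nonsing_inv, hHt]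
  have hKt : K.transpose = K := by
    ext i j
    exact Ks j i
  have h1 : H * H⁻¹ = 1 := Matrix.mul_nonsing_inv _ hdet
  have h2 : H⁻¹ * H = 1 := Matrix.nonsing_inv_mul _ hdet
  have hEe : E = H⁻¹ * A + A.transpose * H⁻¹ := by
    have hD : D = -(A * H + H * A.transpose) := by
      rw [eq_neg_iff_add_eq_zero, ← add_assoc, hK]
    calc E = E * H * H⁻¹ := by rw [Matrix.mul_assoc, h1, Matrix.mul_one]
      _ = -(H⁻¹ * D) * H⁻¹ := by rw [eq_neg_of_add_eq_zero_left hE]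
      _ = H⁻¹ * A * (H * H⁻¹) + (H⁻¹ * H) * A.transpose * H⁻¹ := by
        rw [hD]
        noncomm_ring
      _ = _ := by rw [h1, h2, Matrix.mul_one, Matrix.one_mul]
  have frob : ∀ M N : Matrix (Fin n) (Fin n) ℝ,
      ∑ a, ∑ b, M a b * N a b = (M * N.transpose).trace := by
    intro M N
    simp [Matrix.trace, Matrix.mul_apply]
  have hR : ∀ a b, ∑ d, (K d b * A a d + K a d * A b d)
      = (A * K + K * A.transpose) a b := by
    intro a b
    simp only [Matrix.add_apply, Matrix.mul_apply, Matrix.transpose_apply,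
      ← Finset.sum_add_distrib]
    exact Finset.sum_congr rfl fun _ _ => by ring
  simp only [hR]
  rw [frob, frob, hEe]
  simp only [Matrix.transpose_add, Matrix.transpose_mul, Matrix.transpose_transpose, hKt,
    Matrix.add_mul, Matrix.mul_add, Matrix.trace_add]
  rw [add_comm]
  congr 1
  · rw [Matrix.mul_assoc, Matrix.trace_mul_comm, Matrix.mul_assoc]
  · rw [Matrix.mul_assoc]

theorem contDiff_chrG {n : ℕ} {hmat : (Fin n → ℝ) → Fin n → Fin n → ℝ}
    (hs : ∀ α β, ContDiff ℝ (⊤ : ℕ∞) (fun y => hmat y α β))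
    (hinvert : ∀ y, IsUnit (Matrix.of (hmat y)).det) (γ α β : Fin n) :
    ContDiff ℝ (⊤ : ℕ∞) (fun y => ChrG n hmat y γ α β) := by
  unfold ChrG
  refine contDiff_const.mul (ContDiff.sum fun δ _ => ?_)
  exact (contDiff_matrix_inv (A := fun y => Matrix.of (hmat y)) hs hinvert γ δ).mul
    (((contDiff_pdv (hs _ _) _).add (contDiff_pdv (hs _ _) _)).sub (contDiff_pdv (hs _ _) _))

theorem sum_metric_mul_chrG {n : ℕ} {hmat : (Fin n → ℝ) → Fin n → Fin n → ℝ}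
    (hinvert : ∀ y, IsUnit (Matrix.of (hmat y)).det) (y : Fin n → ℝ) (ε α β : Fin n) :
    ∑ γ, hmat y ε γ * ChrG n hmat y γ α β
      = 1/2 * (pdv α (fun y => hmat y ε β) y + pdv β (fun y => hmat y ε α) y
          - pdv ε (fun y => hmat y α β) y) := by
  set G : Fin n → ℝ := fun δ => pdv α (fun y => hmat y δ β) y + pdv β (fun y => hmat y δ α) y
      - pdv δ (fun y => hmat y α β) y with hG
  have hΓ : (fun γ => ChrG n hmat y γ α β)
      = (1/2 : ℝ) • Matrix.mulVec (Matrix.of (hmat y))⁻¹ G := by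
    funext γ
    simp [ChrG, Matrix.mulVec, dotProduct, hG]
  have h : Matrix.mulVec (Matrix.of (hmat y)) (fun γ => ChrG n hmat y γ α β)
      = (1/2 : ℝ) • G := by
    rw [hΓ, Matrix.mulVec_smul, Matrix.mulVec_mulVec, Matrix.mul_nonsing_inv _ (hinvert y),
      Matrix.one_mulVec]
  exact congrFun h ε

theorem eq_zero_of_sum_mul_eq_zero {n : ℕ} {M : Fin n → Fin n → ℝ}
    (hdet : IsUnit (Matrix.of M).det) {v : Fin n → ℝ}
    (h : ∀ ε, ∑ γ, M ε γ * v γ = 0) (γ : Fin n) : v γ = 0 :=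
  congrFun (Matrix.eq_zero_of_mulVec_eq_zero hdet.ne_zero (funext h)) γ

/-- A Killing field preserves the Levi-Civita connection. -/
theorem lie_chrG_eq_zero_of_killing {n : ℕ} {hmat : (Fin n → ℝ) → Fin n → Fin n → ℝ}
    (hs : ∀ α β, ContDiff ℝ (⊤ : ℕ∞) (fun y => hmat y α β))
    (hsym : ∀ y α β, hmat y α β = hmat y β α)
    (hinvert : ∀ y, IsUnit (Matrix.of (hmat y)).det)
    {χ : (Fin n → ℝ) → Fin n → ℝ} (hχ : ∀ γ, ContDiff ℝ (⊤ : ℕ∞) (fun y => χ y γ))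
    (hkilling : ∀ (y : Fin n → ℝ) (α β : Fin n),
      ∑ γ, (χ y γ * pdv γ (fun y => hmat y α β) y
        + hmat y γ β * pdv α (fun y => χ y γ) y
        + hmat y α γ * pdv β (fun y => χ y γ) y) = 0)
    (y : Fin n → ℝ) (γ α β : Fin n) :
    (∑ δ, χ y δ * pdv δ (fun y => ChrG n hmat y γ α β) y)
      - (∑ δ, pdv δ (fun y => χ y γ) y * ChrG n hmat y δ α β)
      + (∑ δ, ChrG n hmat y γ δ β * pdv α (fun y => χ y δ) y)
      + (∑ δ, ChrG n hmat y γ α δ * pdv β (fun y => χ y δ) y)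
      + pdv α (fun y => pdv β (fun y => χ y γ) y) y = 0 := by
  have hc := contDiff_chrG hs hinvert
  have hpd : ∀ α β μ, ContDiff ℝ (⊤ : ℕ∞) (fun y => pdv μ (fun y => hmat y α β) y) :=
    fun α β μ => contDiff_pdv (hs α β) μ
  have hpχ : ∀ γ μ, ContDiff ℝ (⊤ : ℕ∞) (fun y => pdv μ (fun y => χ y γ) y) :=
    fun γ μ => contDiff_pdv (hχ γ) μ
  have low := lower_lie_christoffel_eq_zero (hmat y)
    (fun μ α β => pdv μ (fun y => hmat y α β) y)
    (fun μ ν α β => pdv μ (fun y => pdv ν (fun y => hmat y α β) y) y)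
    (χ y) (fun μ γ => pdv μ (fun y => χ y γ) y)
    (fun μ ν γ => pdv μ (fun y => pdv ν (fun y => χ y γ) y) y)
    (ChrG n hmat y) (fun μ γ α β => pdv μ (fun y => ChrG n hmat y γ α β) y)
    (hsym y) (fun μ α β => by simp only [hsym _ α β])
    (fun μ ν α β => pdv_comm (hs α β) μ ν y)
    (fun μ ν γ => pdv_comm (hχ γ) μ ν y)
    (sum_metric_mul_chrG hinvert y)
    (fun μ ε α β => by
      have h := congrArg (fun f => pdv μ f y)
        (funext fun y => sum_metric_mul_chrG hinvert y ε α β)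
      rw [pdv_sum (fun γ => (hs ε γ).mul (hc γ α β)),
        pdv_const_mul _ (((hpd _ _ _).add (hpd _ _ _)).sub (hpd _ _ _)),
        pdv_sub ((hpd _ _ _).add (hpd _ _ _)) (hpd _ _ _),
        pdv_add (hpd _ _ _) (hpd _ _ _)] at h
      rw [← h]
      exact Finset.sum_congr rfl fun γ _ => (pdv_mul (hs ε γ) (hc γ α β) μ y).symm)
    (hkilling y)
    (fun μ α β => by
      have h := congrArg (fun f => pdv μ f y) (funext fun y => hkilling y α β)
      simp only [pdv_const] at h
      rw [pdv_sum (fun γ => (((hχ γ).mul (hpd α β γ)).add ((hs γ β).mul (hpχ γ α))).add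
        ((hs α γ).mul (hpχ γ β)))] at h
      rw [← h]
      refine Finset.sum_congr rfl fun γ _ => ?_
      rw [pdv_add (((hχ γ).mul (hpd α β γ)).add ((hs γ β).mul (hpχ γ α)))
          ((hs α γ).mul (hpχ γ β)),
        pdv_add ((hχ γ).mul (hpd α β γ)) ((hs γ β).mul (hpχ γ α)),
        pdv_mul (hχ γ) (hpd α β γ), pdv_mul (hs γ β) (hpχ γ α), pdv_mul (hs α γ) (hpχ γ β)])
  exact eq_zero_of_sum_mul_eq_zero (hinvert y) (fun ε => low ε α β) γ

/-- The spatial components of the Lie derivative of the induced connection are those of the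
Levi-Civita connection of `h`. -/
theorem lieConn_Γind_succ {n : ℕ} (ν₀ : ℝ) {hmat : (Fin n → ℝ) → Fin n → Fin n → ℝ}
    (kmat : (Fin n → ℝ) → Fin n → Fin n → ℝ)
    (hs : ∀ α β, ContDiff ℝ (⊤ : ℕ∞) (fun y => hmat y α β))
    (hinvert : ∀ y, IsUnit (Matrix.of (hmat y)).det) (ω : (Fin n → ℝ) → ℝ)
    {χ : (Fin n → ℝ) → Fin n → ℝ} (hχ : ∀ γ, ContDiff ℝ (⊤ : ℕ∞) (fun y => χ y γ))
    (x : Fin (n+1) → ℝ) (γ α β : Fin n) :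
    LieConn n (Γind n ν₀ hmat kmat) (XfieldTi n ω χ) x γ.succ α.succ β.succ
      = (∑ δ, χ (x ∘ Fin.succ) δ * pdv δ (fun y => ChrG n hmat y γ α β) (x ∘ Fin.succ))
      - (∑ δ, pdv δ (fun y => χ y γ) (x ∘ Fin.succ) * ChrG n hmat (x ∘ Fin.succ) δ α β)
      + (∑ δ, ChrG n hmat (x ∘ Fin.succ) γ δ β * pdv α (fun y => χ y δ) (x ∘ Fin.succ))
      + (∑ δ, ChrG n hmat (x ∘ Fin.succ) γ α δ * pdv β (fun y => χ y δ) (x ∘ Fin.succ))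
      + pdv α (fun y => pdv β (fun y => χ y γ) y) (x ∘ Fin.succ) := by
  have hc := contDiff_chrG hs hinvert
  have h2 : pdv β.succ (fun x : Fin (n+1) → ℝ => χ (x ∘ Fin.succ) γ)
      = fun x => pdv β (fun y => χ y γ) (x ∘ Fin.succ) :=
    funext fun x => pdv_succ_comp_succ (hχ γ) β x
  simp only [LieConn, Fin.sum_univ_succ, Γind, XfieldTi, spatialExt, Fin.cases_zero,
    Fin.cases_succ, pdv_zero_comp_succ (hc _ _ _), pdv_succ_comp_succ (hc _ _ _),
    pdv_zero_comp_succ (hχ _), pdv_succ_comp_succ (hχ _), h2,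
    pdv_succ_comp_succ (contDiff_pdv (hχ _) _)]
  ring

/-- The fibre component of the Lie derivative of the induced connection. -/
theorem lieConn_Γind_zero {n : ℕ} (ν₀ : ℝ) {hmat kmat : (Fin n → ℝ) → Fin n → Fin n → ℝ}
    (hs : ∀ α β, ContDiff ℝ (⊤ : ℕ∞) (fun y => hmat y α β))
    (ks : ∀ α β, ContDiff ℝ (⊤ : ℕ∞) (fun y => kmat y α β))
    {ω : (Fin n → ℝ) → ℝ} (hω : ContDiff ℝ (⊤ : ℕ∞) ω)
    {χ : (Fin n → ℝ) → Fin n → ℝ} (hχ : ∀ γ, ContDiff ℝ (⊤ : ℕ∞) (fun y => χ y γ))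
    (hkilling : ∀ (y : Fin n → ℝ) (α β : Fin n),
      ∑ γ, (χ y γ * pdv γ (fun y => hmat y α β) y
        + hmat y γ β * pdv α (fun y => χ y γ) y
        + hmat y α γ * pdv β (fun y => χ y γ) y) = 0)
    (x : Fin (n+1) → ℝ) (α β : Fin n) :
    LieConn n (Γind n ν₀ hmat kmat) (XfieldTi n ω χ) x 0 α.succ β.succ
      = (pdv α (pdv β ω) (x ∘ Fin.succ)
          - ∑ δ, ChrG n hmat (x ∘ Fin.succ) δ α β * pdv δ ω (x ∘ Fin.succ))
        + ν₀ * ω (x ∘ Fin.succ) * hmat (x ∘ Fin.succ) α β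
        + ν₀ / 2 * ∑ δ, (χ (x ∘ Fin.succ) δ * pdv δ (fun y => kmat y α β) (x ∘ Fin.succ)
          + (kmat (x ∘ Fin.succ) δ β * pdv α (fun y => χ y δ) (x ∘ Fin.succ)
          + kmat (x ∘ Fin.succ) α δ * pdv β (fun y => χ y δ) (x ∘ Fin.succ))) := by
  have h2 : pdv β.succ (fun x : Fin (n+1) → ℝ => ω (x ∘ Fin.succ))
      = fun x => pdv β ω (x ∘ Fin.succ) :=
    funext fun x => pdv_succ_comp_succ hω β x
  have hx0 : ContDiff ℝ (⊤ : ℕ∞) (fun x : Fin (n+1) → ℝ => x 0) := contDiff_apply ℝ ℝ 0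
  have hH := contDiff_comp_succ (hs α β)
  have hKs := contDiff_comp_succ (ks α β)
  have hΓ : ∀ d, pdv d (fun x : Fin (n+1) → ℝ => ν₀ * ((1/2) * kmat (x ∘ Fin.succ) α β
        + x 0 * hmat (x ∘ Fin.succ) α β)) x
      = ν₀ * ((1/2) * pdv d (fun x : Fin (n+1) → ℝ => kmat (x ∘ Fin.succ) α β) x
        + ((if 0 = d then 1 else 0) * hmat (x ∘ Fin.succ) α β
          + x 0 * pdv d (fun x : Fin (n+1) → ℝ => hmat (x ∘ Fin.succ) α β) x)) := by
    intro d
    rw [pdv_const_mul _ ((contDiff_const.mul hKs).add (hx0.mul hH)),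
      pdv_add (contDiff_const.mul hKs) (hx0.mul hH), pdv_const_mul _ hKs, pdv_mul hx0 hH,
      pdv_coord]
  have hsucc : ∀ i : Fin n, ((0 : Fin (n+1)) = i.succ) = False :=
    fun i => eq_false (Fin.succ_ne_zero i).symm
  simp only [LieConn, Fin.sum_univ_succ, Γind, XfieldTi, spatialExt, Fin.cases_zero,
    Fin.cases_succ, hΓ, pdv_zero_comp_succ (hs _ _), pdv_succ_comp_succ (hs _ _),
    pdv_zero_comp_succ (ks _ _), pdv_succ_comp_succ (ks _ _),
    pdv_zero_comp_succ hω, pdv_succ_comp_succ hω,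
    pdv_succ_comp_succ (hχ _), h2, pdv_succ_comp_succ (contDiff_pdv hω _), hsucc]
  have hK := congrArg (fun t => ν₀ * x 0 * t) (hkilling (x ∘ Fin.succ) α β)
  simp only [if_true, if_false, mul_zero, Finset.mul_sum] at hK ⊢
  have hcomm : ∀ δ, pdv δ ω (x ∘ Fin.succ) * ChrG n hmat (x ∘ Fin.succ) δ α β
      = ChrG n hmat (x ∘ Fin.succ) δ α β * pdv δ ω (x ∘ Fin.succ) := fun δ => mul_comm _ _
  simp only [hcomm]
  refine sub_eq_zero.1 (Eq.trans ?_ hK)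
  ring_nf
  simp only [Finset.sum_add_distrib]
  ring_nf

/-- For a Killing field `χ`, the derivative of the trace `h^{βγ}k_{βγ}` along `χ` is the trace of
the Lie derivative of `k`. -/
theorem sum_mul_pdv_trace_of_killing {n : ℕ} {hmat kmat : (Fin n → ℝ) → Fin n → Fin n → ℝ}
    (hs : ∀ α β, ContDiff ℝ (⊤ : ℕ∞) (fun y => hmat y α β))
    (hsym : ∀ y α β, hmat y α β = hmat y β α)
    (hinvert : ∀ y, IsUnit (Matrix.of (hmat y)).det)
    (ks : ∀ α β, ContDiff ℝ (⊤ : ℕ∞) (fun y => kmat y α β))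
    (ksym : ∀ y α β, kmat y α β = kmat y β α)
    {χ : (Fin n → ℝ) → Fin n → ℝ}
    (hkilling : ∀ (y : Fin n → ℝ) (α β : Fin n),
      ∑ γ, (χ y γ * pdv γ (fun y => hmat y α β) y
        + hmat y γ β * pdv α (fun y => χ y γ) y
        + hmat y α γ * pdv β (fun y => χ y γ) y) = 0)
    (y : Fin n → ℝ) :
    ∑ α, χ y α * pdv α (fun y => ∑ β, ∑ γ, (Matrix.of (hmat y))⁻¹ β γ * kmat y β γ) y
      = ∑ β, ∑ γ, (Matrix.of (hmat y))⁻¹ β γ *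
          ∑ δ, (χ y δ * pdv δ (fun y => kmat y β γ) y
            + (kmat y δ γ * pdv β (fun y => χ y δ) y
              + kmat y β δ * pdv γ (fun y => χ y δ) y)) := by
  have hi : ∀ β γ, ContDiff ℝ (⊤ : ℕ∞) (fun y => (Matrix.of (hmat y))⁻¹ β γ) :=
    contDiff_matrix_inv (A := fun y => Matrix.of (hmat y)) hs hinvert
  have hE := sum_lie_inv_mul (H := Matrix.of (hmat y))
    (D := Matrix.of fun β γ => ∑ α, χ y α * pdv α (fun y => hmat y β γ) y)
    (E := Matrix.of fun β γ =>
      ∑ α, χ y α * pdv α (fun y => (Matrix.of (hmat y))⁻¹ β γ) y)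
    (A := Matrix.of fun β γ => pdv β (fun y => χ y γ) y)
    (K := Matrix.of (kmat y)) (hinvert y) (hsym y) (ksym y)
    (by
      ext β γ
      have h := hkilling y β γ
      simp only [Finset.sum_add_distrib] at h
      simp only [Matrix.add_apply, Matrix.mul_apply, Matrix.of_apply, Matrix.transpose_apply,
        Matrix.zero_apply]
      rw [← h]
      simp only [mul_comm])
    (by
      ext β γ
      have hone : ∀ α, pdv α (fun y => ∑ δ, (Matrix.of (hmat y))⁻¹ β δ * hmat y δ γ) y = 0 := by
        intro α
        have hc : (fun y => ∑ δ, (Matrix.of (hmat y))⁻¹ β δ * hmat y δ γ)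
            = fun _ => (1 : Matrix (Fin n) (Fin n) ℝ) β γ := by
          funext z
          rw [← Matrix.nonsing_inv_mul _ (hinvert z)]
          simp [Matrix.mul_apply]
        rw [hc, pdv_const]
      simp only [pdv_sum fun δ => (hi β δ).mul (hs δ γ), pdv_mul (hi _ _) (hs _ _)] at hone
      have hsum : ∑ α, χ y α * ∑ δ, (pdv α (fun y => (Matrix.of (hmat y))⁻¹ β δ) y * hmat y δ γ
          + (Matrix.of (hmat y))⁻¹ β δ * pdv α (fun y => hmat y δ γ) y) = 0 := by
        simp only [hone, mul_zero, Finset.sum_const_zero]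
      simp only [Matrix.add_apply, Matrix.mul_apply, Matrix.of_apply, Matrix.zero_apply]
      rw [← hsum]
      simp only [Finset.mul_sum, Finset.sum_mul, ← Finset.sum_add_distrib]
      rw [Finset.sum_comm]
      exact Finset.sum_congr rfl fun _ _ => Finset.sum_congr rfl fun _ _ => by ring)
  simp only [Matrix.of_apply] at hE
  have hd : ∀ α, pdv α (fun y => ∑ β, ∑ γ, (Matrix.of (hmat y))⁻¹ β γ * kmat y β γ) y
      = ∑ β, ∑ γ, (pdv α (fun y => (Matrix.of (hmat y))⁻¹ β γ) y * kmat y β γ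
        + (Matrix.of (hmat y))⁻¹ β γ * pdv α (fun y => kmat y β γ) y) := by
    intro α
    rw [pdv_sum fun β => ContDiff.sum fun γ _ => (hi β γ).mul (ks β γ)]
    refine Finset.sum_congr rfl fun β _ => ?_
    rw [pdv_sum fun γ => (hi β γ).mul (ks β γ)]
    exact Finset.sum_congr rfl fun γ _ => pdv_mul (hi β γ) (ks β γ) α y
  have hsplit : ∀ β γ, (Matrix.of (hmat y))⁻¹ β γ *
        ∑ δ, (χ y δ * pdv δ (fun y => kmat y β γ) y
          + (kmat y δ γ * pdv β (fun y => χ y δ) y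
            + kmat y β δ * pdv γ (fun y => χ y δ) y))
      = (Matrix.of (hmat y))⁻¹ β γ * (∑ δ, χ y δ * pdv δ (fun y => kmat y β γ) y)
        + (Matrix.of (hmat y))⁻¹ β γ * ∑ δ, (kmat y δ γ * pdv β (fun y => χ y δ) y
            + kmat y β δ * pdv γ (fun y => χ y δ) y) := by
    intro β γ
    rw [Finset.sum_add_distrib, mul_add]
  simp only [hsplit, Finset.sum_add_distrib (f := fun γ => (Matrix.of (hmat y))⁻¹ _ γ * _),
    Finset.sum_add_distrib (f := fun β => ∑ γ, (Matrix.of (hmat y))⁻¹ β γ * _)]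
  rw [← hE]
  simp only [hd, Finset.mul_sum, Finset.sum_mul, ← Finset.sum_add_distrib]
  rw [Finset.sum_comm]
  refine Finset.sum_congr rfl fun β _ => ?_
  rw [Finset.sum_comm]
  exact Finset.sum_congr rfl fun γ _ => Finset.sum_congr rfl fun α _ => by ring

/-- Troessaert's BMS condition `h^{cb}(L_X∇_c)^a{}_b = 0` for
`X = ω(y)∂_u + χ^α(y)∂_α` with `χ` Killing is equivalent to the single scalar equation
`h^{βγ}D_βD_γω + nν₀ω = -(ν₀/2) χ^α∂_α k` where `k = h^{βγ}k_{βγ}`. -/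
theorem troessaert_bms_condition_iff_scalar_equation
    (n : ℕ) (hn : 1 ≤ n) (ν₀ : ℝ)
    (hmat : (Fin n → ℝ) → Fin n → Fin n → ℝ)
    (hsm : ContDiff ℝ (⊤ : ℕ∞) hmat)
    (hsym : ∀ (y : Fin n → ℝ) (α β : Fin n), hmat y α β = hmat y β α)
    (hinvert : ∀ y : Fin n → ℝ, IsUnit (Matrix.of (hmat y)).det)
    (hconst : ∀ (y : Fin n → ℝ) (α β γ δ : Fin n),
      Riem n hmat y α β γ δ
        = ν₀ * ((if α = γ then 1 else 0) * hmat y δ β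
            - (if α = δ then 1 else 0) * hmat y γ β))
    (kmat : (Fin n → ℝ) → Fin n → Fin n → ℝ)
    (ksm : ContDiff ℝ (⊤ : ℕ∞) kmat)
    (ksym : ∀ (y : Fin n → ℝ) (α β : Fin n), kmat y α β = kmat y β α)
    (ω : (Fin n → ℝ) → ℝ) (hωsm : ContDiff ℝ (⊤ : ℕ∞) ω)
    (χ : (Fin n → ℝ) → Fin n → ℝ) (hχsm : ContDiff ℝ (⊤ : ℕ∞) χ)
    (hkilling : ∀ (y : Fin n → ℝ) (α β : Fin n),
      ∑ γ, (χ y γ * pdv γ (fun y => hmat y α β) y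
        + hmat y γ β * pdv α (fun y => χ y γ) y
        + hmat y α γ * pdv β (fun y => χ y γ) y) = 0) :
    (∀ (x : Fin (n+1) → ℝ) (a : Fin (n+1)),
        ∑ β : Fin n, ∑ γ : Fin n,
          (Matrix.of (hmat (x ∘ Fin.succ)))⁻¹ β γ *
            LieConn n (Γind n ν₀ hmat kmat) (XfieldTi n ω χ) x a β.succ γ.succ = 0)
      ↔ (∀ y : Fin n → ℝ,
          (∑ β : Fin n, ∑ γ : Fin n,
              (Matrix.of (hmat y))⁻¹ β γ *
                (pdv β (pdv γ ω) y - ∑ δ, ChrG n hmat y δ β γ * pdv δ ω y))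
              + (n : ℝ) * ν₀ * ω y
            = -(ν₀/2) * ∑ α : Fin n, χ y α *
                pdv α (fun y => ∑ β : Fin n, ∑ γ : Fin n,
                  (Matrix.of (hmat y))⁻¹ β γ * kmat y β γ) y) := by
  have hs : ∀ α β, ContDiff ℝ (⊤ : ℕ∞) (fun y => hmat y α β) :=
    fun α β => contDiff_pi.1 (contDiff_pi.1 hsm α) β
  have ks : ∀ α β, ContDiff ℝ (⊤ : ℕ∞) (fun y => kmat y α β) :=
    fun α β => contDiff_pi.1 (contDiff_pi.1 ksm α) β
  have hχ : ∀ γ, ContDiff ℝ (⊤ : ℕ∞) (fun y => χ y γ) := contDiff_pi.1 hχsm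
  have hspatial : ∀ (x : Fin (n+1) → ℝ) (α β γ : Fin n),
      LieConn n (Γind n ν₀ hmat kmat) (XfieldTi n ω χ) x α.succ β.succ γ.succ = 0 := by
    intro x α β γ
    rw [lieConn_Γind_succ ν₀ kmat hs hinvert ω hχ]
    exact lie_chrG_eq_zero_of_killing hs hsym hinvert hχ hkilling _ α β γ
  have hfibre : ∀ x : Fin (n+1) → ℝ,
      ∑ β : Fin n, ∑ γ : Fin n, (Matrix.of (hmat (x ∘ Fin.succ)))⁻¹ β γ *
        LieConn n (Γind n ν₀ hmat kmat) (XfieldTi n ω χ) x 0 β.succ γ.succ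
      = (∑ β : Fin n, ∑ γ : Fin n, (Matrix.of (hmat (x ∘ Fin.succ)))⁻¹ β γ *
          (pdv β (pdv γ ω) (x ∘ Fin.succ)
            - ∑ δ, ChrG n hmat (x ∘ Fin.succ) δ β γ * pdv δ ω (x ∘ Fin.succ)))
        + (n : ℝ) * ν₀ * ω (x ∘ Fin.succ)
        + ν₀/2 * ∑ α : Fin n, χ (x ∘ Fin.succ) α *
            pdv α (fun y => ∑ β : Fin n, ∑ γ : Fin n,
              (Matrix.of (hmat y))⁻¹ β γ * kmat y β γ) (x ∘ Fin.succ) := by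
    intro x
    have htr := sum_inv_mul_of_symm (hinvert (x ∘ Fin.succ)) (hsym (x ∘ Fin.succ))
    rw [sum_mul_pdv_trace_of_killing hs hsym hinvert ks ksym hkilling, mul_assoc, ← htr,
      Finset.sum_mul, Finset.mul_sum, ← Finset.sum_add_distrib, ← Finset.sum_add_distrib]
    refine Finset.sum_congr rfl fun β _ => ?_
    rw [Finset.sum_mul, Finset.mul_sum, ← Finset.sum_add_distrib, ← Finset.sum_add_distrib]
    refine Finset.sum_congr rfl fun γ _ => ?_
    rw [lieConn_Γind_zero ν₀ hs ks hωsm hχ hkilling, Matrix.of_apply]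
    ring
  constructor
  · intro h y
    have hy : (Fin.cons 0 y : Fin (n+1) → ℝ) ∘ Fin.succ = y := by
      funext i
      simp
    have h0 := (hfibre (Fin.cons 0 y)).symm.trans (h (Fin.cons 0 y) 0)
    rw [hy] at h0
    linarith
  · intro h x a
    refine Fin.cases ?_ (fun α => ?_) a
    · rw [hfibre]
      linarith [h (x ∘ Fin.succ)]
    · simp only [hspatial, mul_zero, Finset.sum_const_zero]
end
end

section
/- Let n ≥ 2 and let ξ : ℝ^{n−1} → ℝ be continuous and compactly supported. Define ω : ℝ^n → ℝ by the bulk-to-boundary propagator ω(y) = ∫_{ℝ^{n−1}} ξ(z) ( −η(P̃(y), Q̃(z)) )^{−n} dz. Then ω is smooth and satisfies the SPI-supertranslation equation (D² + ν₀ n)ω = 0 with ν₀ = −1 on hyperbolic space, i.e. Σ_{α,β} h^{αβ}(y) ( ∂_α∂_β ω(y) − Σ_γ Γ^γ_{αβ}(y) ∂_γ ω(y) ) = n ω(y) for all y ∈ ℝ^n. This realises the canonical embedding of BMS supertranslations into SPI supertranslations at timelike infinity. -/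
open scoped BigOperators
open Filter MeasureTheory

noncomputable section

/-- Minkowski inner product on `ℝ^{1,n}` (mostly plus signature). -/
def minkowski (n : ℕ) (X Y : Fin (n+1) → ℝ) : ℝ :=
  -(X 0 * Y 0) + ∑ i : Fin n, X i.succ * Y i.succ

/-- Parametrization of the future unit hyperboloid `H^n ⊂ ℝ^{1,n}`. -/
def hyp (n : ℕ) (y : Fin n → ℝ) : Fin (n+1) → ℝ :=
  Fin.cons (Real.sqrt (1 + ∑ i, y i ^ 2)) y

/-- Null-cone parametrization of the celestial sphere in stereographic coordinates:
`Q̃(z) = (1+|z|², 2z¹,…,2z^{n-1}, 1-|z|²) ∈ ℝ^{1,n}` (here `n = m+1`, `z ∈ ℝᵐ`). -/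
def cone (m : ℕ) (z : Fin m → ℝ) : Fin (m+1+1) → ℝ :=
  Fin.cons (1 + ∑ i, z i ^ 2) (Fin.snoc (fun i => 2 * z i) (1 - ∑ i, z i ^ 2))

/-- The hyperbolic metric in the chart: `h_{αβ}(y) = δ_{αβ} - y_α y_β/(1+|y|²)`. -/
def hmet (n : ℕ) (y : Fin n → ℝ) (α β : Fin n) : ℝ :=
  (if α = β then 1 else 0) - y α * y β / (1 + ∑ i, y i ^ 2)

/-- The inverse hyperbolic metric in the chart: `h^{αβ}(y) = δ^{αβ} + y^α y^β`. -/
def hinvmet (n : ℕ) (y : Fin n → ℝ) (α β : Fin n) : ℝ :=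
  (if α = β then 1 else 0) + y α * y β

/-- Christoffel symbols of the hyperbolic metric. -/
def Chr (n : ℕ) (y : Fin n → ℝ) (γ α β : Fin n) : ℝ :=
  (1/2) * ∑ δ, hinvmet n y γ δ *
    (pdv α (fun y => hmet n y δ β) y + pdv β (fun y => hmet n y δ α) y
      - pdv δ (fun y => hmet n y α β) y)

/-- Integrating a jointly smooth function against a continuous compactly supported weight:
the derivative may be taken under the integral sign. -/
theorem hasFDerivAt_integral_weight_mul {P Z : Type*}
    [NormedAddCommGroup P] [NormedSpace ℝ P] [FiniteDimensional ℝ P]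
    [NormedAddCommGroup Z] [NormedSpace ℝ Z] [FiniteDimensional ℝ Z]
    [MeasurableSpace Z] [BorelSpace Z] {μ : Measure Z} [IsFiniteMeasureOnCompacts μ]
    {ξ : Z → ℝ} (hξ : Continuous ξ) (hs : HasCompactSupport ξ)
    {F : P → Z → ℝ} (hF : ContDiff ℝ 1 (Function.uncurry F)) (p : P) :
    HasFDerivAt (fun p => ∫ z, ξ z * F p z ∂μ)
      (∫ z, ξ z • fderiv ℝ (fun p => F p z) p ∂μ) p := by
  have : ProperSpace P := FiniteDimensional.proper ℝ P
  have hD : Continuous (fun q : P × Z => fderiv ℝ (fun p => F p q.2) q.1) := by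
    have h : ContDiff ℝ 1 (Function.uncurry fun (q : P × Z) (p : P) => F p q.2) :=
      hF.comp (contDiff_snd.prodMk (contDiff_snd.comp contDiff_fst))
    exact (h.fderiv (n := 0) contDiff_fst (by simp)).continuous
  have hFc (p : P) : Continuous (F p) := hF.continuous.comp (Continuous.prodMk_right p)
  have hsupp (x : Z) (hx : x ∉ tsupport ξ) : ξ x = 0 := image_eq_zero_of_notMem_tsupport hx
  obtain ⟨M, hM⟩ := ((isCompact_closedBall p 1).prod hs.isCompact).bddAbove_image
    hD.norm.continuousOn
  refine hasFDerivAt_integral_of_dominated_of_fderiv_le (bound := fun z => |ξ z| * M)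
    (F' := fun p z => ξ z • fderiv ℝ (fun p => F p z) p)
    (Metric.closedBall_mem_nhds p one_pos) (.of_forall fun q => ?_) ?_ ?_
    (.of_forall fun z q hq => ?_) ?_ (.of_forall fun z q _ => ?_)
  · exact (hξ.mul (hFc q)).aestronglyMeasurable
  · exact (hξ.mul (hFc p)).integrable_of_hasCompactSupport hs.mul_right
  · exact (hξ.smul (hD.comp (Continuous.prodMk_right p))).aestronglyMeasurable
  · rw [norm_smul, Real.norm_eq_abs]
    by_cases hz : z ∈ tsupport ξ
    · exact mul_le_mul_of_nonneg_left (hM ⟨(q, z), ⟨hq, hz⟩, rfl⟩) (abs_nonneg _)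
    · simp [hsupp z hz]
  · exact (hξ.abs.mul continuous_const).integrable_of_hasCompactSupport
      (HasCompactSupport.mul_right (hs.comp_left (g := fun x : ℝ => |x|) abs_zero))
  · have h : ContDiff ℝ 1 (fun p => F p z) := hF.comp (contDiff_id.prodMk contDiff_const)
    exact ((h.differentiable one_ne_zero q).hasFDerivAt).const_mul (ξ z)

theorem fderiv_integral_weight_mul_apply {P Z : Type*}
    [NormedAddCommGroup P] [NormedSpace ℝ P] [FiniteDimensional ℝ P]
    [NormedAddCommGroup Z] [NormedSpace ℝ Z] [FiniteDimensional ℝ Z]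
    [MeasurableSpace Z] [BorelSpace Z] {μ : Measure Z} [IsFiniteMeasureOnCompacts μ]
    {ξ : Z → ℝ} (hξ : Continuous ξ) (hs : HasCompactSupport ξ)
    {F : P → Z → ℝ} (hF : ContDiff ℝ 1 (Function.uncurry F)) (p v : P) :
    fderiv ℝ (fun p => ∫ z, ξ z * F p z ∂μ) p v
      = ∫ z, ξ z * fderiv ℝ (fun p => F p z) p v ∂μ := by
  rw [(hasFDerivAt_integral_weight_mul hξ hs hF p).fderiv, ContinuousLinearMap.integral_apply]
  · simp
  · have h : ContDiff ℝ 1 (Function.uncurry fun (z : Z) (p : P) => F p z) :=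
      hF.comp (contDiff_snd.prodMk contDiff_fst)
    have hD : Continuous (fun z => fderiv ℝ (fun p => F p z) p) :=
      (h.fderiv (n := 0) contDiff_const (by simp)).continuous
    exact (hξ.smul hD).integrable_of_hasCompactSupport hs.smul_right

theorem contDiff_uncurry_fderiv_apply {P Z : Type*}
    [NormedAddCommGroup P] [NormedSpace ℝ P] [NormedAddCommGroup Z] [NormedSpace ℝ Z]
    {F : P → Z → ℝ} (hF : ContDiff ℝ (⊤ : ℕ∞) (Function.uncurry F)) (v : P) :
    ContDiff ℝ (⊤ : ℕ∞) (Function.uncurry fun p z => fderiv ℝ (fun p => F p z) p v) := by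
  have h : ContDiff ℝ (⊤ : ℕ∞) (Function.uncurry fun (q : P × Z) (p : P) => F p q.2) :=
    hF.comp (contDiff_snd.prodMk (contDiff_snd.comp contDiff_fst))
  exact (h.fderiv (n := (⊤ : ℕ∞)) contDiff_fst (by simp)).clm_apply contDiff_const

theorem contDiff_integral_weight_mul {P Z : Type*}
    [NormedAddCommGroup P] [NormedSpace ℝ P] [FiniteDimensional ℝ P]
    [NormedAddCommGroup Z] [NormedSpace ℝ Z] [FiniteDimensional ℝ Z]
    [MeasurableSpace Z] [BorelSpace Z] {μ : Measure Z} [IsFiniteMeasureOnCompacts μ]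
    {ξ : Z → ℝ} (hξ : Continuous ξ) (hs : HasCompactSupport ξ)
    {F : P → Z → ℝ} (hF : ContDiff ℝ (⊤ : ℕ∞) (Function.uncurry F)) :
    ContDiff ℝ (⊤ : ℕ∞) (fun p => ∫ z, ξ z * F p z ∂μ) := by
  have hdiff {F : P → Z → ℝ} (hF : ContDiff ℝ (⊤ : ℕ∞) (Function.uncurry F)) :
      Differentiable ℝ (fun p => ∫ z, ξ z * F p z ∂μ) := fun p =>
    (hasFDerivAt_integral_weight_mul hξ hs (hF.of_le (by simp)) p).differentiableAt
  refine contDiff_infty.2 fun n => ?_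
  induction n generalizing F with
  | zero => exact contDiff_zero.2 (hdiff hF).continuous
  | succ n ih =>
    push_cast
    refine contDiff_succ_iff_fderiv_apply.2 ⟨hdiff hF, by simp, fun v => ?_⟩
    simp_rw [fderiv_integral_weight_mul_apply hξ hs (hF.of_le (by simp))]
    exact ih (contDiff_uncurry_fderiv_apply hF v)

theorem one_add_sum_sq_pos {n : ℕ} (y : Fin n → ℝ) : 0 < 1 + ∑ i, y i ^ 2 := by
  positivity

theorem hasFDerivAt_one_add_sum_sq {n : ℕ} (y : Fin n → ℝ) :
    HasFDerivAt (fun y : Fin n → ℝ => 1 + ∑ i, y i ^ 2)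
      (∑ i, (2 * y i) • ContinuousLinearMap.proj (R := ℝ) (φ := fun _ : Fin n => ℝ) i) y := by
  refine (HasFDerivAt.fun_sum fun i _ => ?_).const_add 1
  simpa using (hasFDerivAt_apply (𝕜 := ℝ) i y).pow 2

theorem pdv_hmet {n : ℕ} (y : Fin n → ℝ) (δ α β : Fin n) :
    pdv δ (fun y => hmet n y α β) y
      = -((if α = δ then 1 else 0) * y β + y α * (if β = δ then 1 else 0)) / (1 + ∑ i, y i ^ 2)
        + 2 * y α * y β * y δ / (1 + ∑ i, y i ^ 2) ^ 2 := by
  have hw := (one_add_sum_sq_pos y).ne'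
  have h := (((hasFDerivAt_apply (𝕜 := ℝ) α y).mul (hasFDerivAt_apply (𝕜 := ℝ) β y)).mul
    (((hasDerivAt_inv hw).comp_hasFDerivAt y (hasFDerivAt_one_add_sum_sq y)))).const_sub
    (if α = β then 1 else 0)
  have h' : HasFDerivAt (fun y => hmet n y α β) _ y := h
  rw [pdv, h'.fderiv]
  simp only [Pi.mul_apply, Function.comp_apply, neg_apply,
    add_apply, smul_apply, sum_apply,
    ContinuousLinearMap.proj_apply, Pi.single_apply, smul_eq_mul, mul_ite, mul_one, mul_zero,
    Finset.sum_ite_eq', Finset.mem_univ, if_true]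
  split_ifs <;> field_simp <;> ring

theorem sum_hinvmet_mul {n : ℕ} (y : Fin n → ℝ) (γ : Fin n) :
    ∑ δ, hinvmet n y γ δ * y δ = (1 + ∑ i, y i ^ 2) * y γ := by
  simp only [hinvmet, add_mul, Finset.sum_add_distrib, ite_mul, one_mul, zero_mul,
    Finset.sum_ite_eq, Finset.mem_univ, if_true, Finset.sum_mul]
  congr 1
  exact Finset.sum_congr rfl fun i _ => by ring

theorem Chr_eq {n : ℕ} (y : Fin n → ℝ) (γ α β : Fin n) :
    Chr n y γ α β = -y γ * hmet n y α β := by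
  have hw := (one_add_sum_sq_pos y).ne'
  have h (δ : Fin n) : hinvmet n y γ δ * (pdv α (fun y => hmet n y δ β) y
      + pdv β (fun y => hmet n y δ α) y - pdv δ (fun y => hmet n y α β) y)
      = (-2 * hmet n y α β / (1 + ∑ i, y i ^ 2)) * (hinvmet n y γ δ * y δ) := by
    simp only [pdv_hmet]
    simp only [hmet, eq_comm (a := δ), eq_comm (a := β) (b := α)]
    generalize 1 + ∑ i, y i ^ 2 = w at *
    field_simp
    ring
  simp only [Chr, h, ← Finset.mul_sum, sum_hinvmet_mul]
  field_simp

theorem sum_sum_hinvmet_mul {n : ℕ} (y : Fin n → ℝ) (T : Fin n → Fin n → ℝ) :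
    ∑ α, ∑ β, hinvmet n y α β * T α β = ∑ α, T α α + ∑ α, ∑ β, y α * y β * T α β := by
  simp [hinvmet, add_mul, Finset.sum_add_distrib]

theorem sum_sum_mul_mul {n : ℕ} (u v : Fin n → ℝ) :
    ∑ α, ∑ β, u α * v β = (∑ α, u α) * ∑ β, v β := Finset.sum_mul_sum .. |>.symm

theorem trace_hmet {n : ℕ} (y : Fin n → ℝ) :
    ∑ α, ∑ β, hinvmet n y α β * hmet n y α β = n := by
  have hw := (one_add_sum_sq_pos y).ne'
  have h2 : ∑ α, ∑ β, y α * y β * hmet n y α β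
      = ∑ α, y α ^ 2 - (∑ α, y α ^ 2) * (∑ α, y α ^ 2) / (1 + ∑ i, y i ^ 2) := by
    rw [← sum_sum_mul_mul, Finset.sum_div, ← Finset.sum_sub_distrib]
    refine Finset.sum_congr rfl fun α _ => ?_
    simp only [hmet, mul_sub, Finset.sum_sub_distrib, mul_ite, mul_one, mul_zero,
      Finset.sum_ite_eq, Finset.mem_univ, if_true, Finset.sum_div]
    congr 1
    · ring
    · exact Finset.sum_congr rfl fun i _ => by ring
  have h1 : ∑ α, hmet n y α α = n - (∑ α, y α ^ 2) / (1 + ∑ i, y i ^ 2) := by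
    simp [hmet, Finset.sum_div, sq]
  rw [sum_sum_hinvmet_mul, h1, h2]
  field_simp
  ring

/-- In the chart `y`, the Laplace-Beltrami operator of hyperbolic space is
`h^{αβ} ∂_α ∂_β + n y^γ ∂_γ`. -/
theorem laplacian_eq {n : ℕ} (f : (Fin n → ℝ) → ℝ) (y : Fin n → ℝ) :
    ∑ α, ∑ β, hinvmet n y α β * (pdv α (pdv β f) y - ∑ γ, Chr n y γ α β * pdv γ f y)
      = ∑ α, ∑ β, hinvmet n y α β * pdv α (pdv β f) y + n * ∑ γ, y γ * pdv γ f y := by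
  have h (α β : Fin n) : ∑ γ, Chr n y γ α β * pdv γ f y
      = -hmet n y α β * ∑ γ, y γ * pdv γ f y := by
    rw [Finset.mul_sum]
    exact Finset.sum_congr rfl fun γ _ => by rw [Chr_eq]; ring
  simp only [h]
  rw [← trace_hmet y, Finset.sum_mul, ← Finset.sum_add_distrib]
  refine Finset.sum_congr rfl fun α _ => ?_
  rw [Finset.sum_mul, ← Finset.sum_add_distrib]
  exact Finset.sum_congr rfl fun β _ => by ring

theorem hasFDerivAt_sqrt_one_add_sum_sq {n : ℕ} (y : Fin n → ℝ) :
    HasFDerivAt (fun y : Fin n → ℝ => √(1 + ∑ i, y i ^ 2))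
      ((√(1 + ∑ i, y i ^ 2))⁻¹ •
        ∑ i, y i • ContinuousLinearMap.proj (R := ℝ) (φ := fun _ : Fin n => ℝ) i) y := by
  refine ((hasFDerivAt_one_add_sum_sq y).sqrt (one_add_sum_sq_pos y).ne').congr_fderiv ?_
  rw [Finset.smul_sum, Finset.smul_sum]
  refine Finset.sum_congr rfl fun i _ => ?_
  rw [smul_smul, smul_smul]
  congr 1
  field_simp

/-- Minus the pairing of the point `y` of the hyperboloid with the vector `(E, b)`. -/
def pairing {n : ℕ} (E : ℝ) (b y : Fin n → ℝ) : ℝ :=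
  √(1 + ∑ i, y i ^ 2) * E - ∑ i, b i * y i

theorem pairing_pos {n : ℕ} {E : ℝ} {b : Fin n → ℝ} (hE : 0 < E) (hb : ∑ i, b i ^ 2 = E ^ 2)
    (y : Fin n → ℝ) : 0 < pairing E b y := by
  have hcs := Finset.sum_mul_sq_le_sq_mul_sq Finset.univ b y
  have hw := one_add_sum_sq_pos y
  rw [pairing, sub_pos]
  refine lt_of_pow_lt_pow_left₀ 2 (by positivity) ?_
  rw [mul_pow, Real.sq_sqrt hw.le]
  rw [hb] at hcs
  nlinarith [sq_pos_of_pos hE]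

theorem hasFDerivAt_pairing {n : ℕ} (E : ℝ) (b y : Fin n → ℝ) :
    HasFDerivAt (pairing E b)
      (∑ i, (E / √(1 + ∑ i, y i ^ 2) * y i - b i) •
        ContinuousLinearMap.proj (R := ℝ) (φ := fun _ : Fin n => ℝ) i) y := by
  have h2 : HasFDerivAt (fun y : Fin n → ℝ => ∑ i, b i * y i)
      (∑ i, b i • ContinuousLinearMap.proj (R := ℝ) (φ := fun _ : Fin n => ℝ) i) y :=
    HasFDerivAt.fun_sum fun i _ => (hasFDerivAt_apply (𝕜 := ℝ) i y).const_mul (b i)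
  refine (((hasFDerivAt_sqrt_one_add_sum_sq y).mul_const E).sub h2).congr_fderiv ?_
  rw [smul_smul, Finset.smul_sum, ← Finset.sum_sub_distrib]
  refine Finset.sum_congr rfl fun i _ => ?_
  rw [smul_smul, ← sub_smul, div_eq_mul_inv]

theorem pdv_pairing_rpow {n : ℕ} {E : ℝ} {b y : Fin n → ℝ} (hu : 0 < pairing E b y) (p : ℝ)
    (β : Fin n) :
    pdv β (fun y => pairing E b y ^ p) y
      = p * pairing E b y ^ (p - 1) * (E / √(1 + ∑ i, y i ^ 2) * y β - b β) := by
  rw [pdv, ((hasFDerivAt_pairing E b y).rpow_const (.inl hu.ne')).fderiv]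
  simp [Pi.single_apply]

theorem pdv_pdv_pairing_rpow {n : ℕ} {E : ℝ} {b : Fin n → ℝ} (hu : ∀ y, 0 < pairing E b y)
    (p : ℝ) (y : Fin n → ℝ) (α β : Fin n) :
    pdv α (pdv β (fun y => pairing E b y ^ p)) y
      = p * (p - 1) * pairing E b y ^ (p - 2) * ((E / √(1 + ∑ i, y i ^ 2) * y α - b α)
          * (E / √(1 + ∑ i, y i ^ 2) * y β - b β))
        + p * pairing E b y ^ (p - 1) * (E / √(1 + ∑ i, y i ^ 2)
          * ((if α = β then 1 else 0) - y α * y β / (1 + ∑ i, y i ^ 2))) := by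
  have hfun : pdv β (fun y => pairing E b y ^ p) = fun y =>
      p * pairing E b y ^ (p - 1) * (E * (√(1 + ∑ i, y i ^ 2))⁻¹ * y β - b β) :=
    funext fun y => by rw [pdv_pairing_rpow (hu y), div_eq_mul_inv]
  have hw := one_add_sum_sq_pos y
  have hs : √(1 + ∑ i, y i ^ 2) ≠ 0 := (Real.sqrt_pos.2 hw).ne'
  have h := (((hasFDerivAt_pairing E b y).rpow_const (p := p - 1) (.inl (hu y).ne')).const_mul
    p).mul (((((hasDerivAt_inv hs).comp_hasFDerivAt y
      (hasFDerivAt_sqrt_one_add_sum_sq y)).const_mul E).mul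
        (hasFDerivAt_apply (𝕜 := ℝ) β y)).sub_const (b β))
  rw [pdv, hfun]
  refine (congrArg (fun L => L (Pi.single α 1)) (HasFDerivAt.fderiv h)).trans ?_
  have hp : p - 1 - 1 = p - 2 := by ring
  simp only [Pi.mul_apply, Function.comp_apply, add_apply,
    smul_apply, sum_apply, ContinuousLinearMap.proj_apply,
    Pi.single_apply, smul_eq_mul, mul_ite, mul_one, mul_zero, Finset.sum_ite_eq', Finset.mem_univ,
    if_true, hp, eq_comm (a := β) (b := α)]
  have hsq := Real.sq_sqrt hw.le
  generalize √(1 + ∑ i, y i ^ 2) = s at *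
  rw [← hsq]
  split_ifs <;> field_simp <;> ring

/-- For a null vector `(E, b)`, the `-n`-th power of its pairing with the hyperboloid solves the
SPI-supertranslation equation. -/
theorem laplacian_pairing_rpow {n : ℕ} {E : ℝ} {b : Fin n → ℝ} (hE : 0 < E)
    (hb : ∑ i, b i ^ 2 = E ^ 2) (y : Fin n → ℝ) :
    ∑ α, ∑ β, hinvmet n y α β * pdv α (pdv β (fun y => pairing E b y ^ (-(n : ℝ)))) y
        + n * ∑ γ, y γ * pdv γ (fun y => pairing E b y ^ (-(n : ℝ))) y
      = n * pairing E b y ^ (-(n : ℝ)) := by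
  have hu := pairing_pos hE hb
  have hw := one_add_sum_sq_pos y
  have hs := Real.sqrt_pos.2 hw
  have hsq := Real.sq_sqrt hw.le
  have hpow1 : pairing E b y ^ (-(n : ℝ) - 1) = pairing E b y ^ (-(n : ℝ) - 2) * pairing E b y := by
    rw [← Real.rpow_add_one (hu y).ne']
    ring_nf
  have hpow0 : pairing E b y ^ (-(n : ℝ)) = pairing E b y ^ (-(n : ℝ) - 2) * pairing E b y ^ 2 := by
    rw [← Real.rpow_natCast, ← Real.rpow_add (hu y)]
    norm_num
  have hgrad (a : ℝ) : ∑ γ, y γ * (a * y γ - b γ) = a * ∑ i, y i ^ 2 - ∑ i, b i * y i := by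
    rw [Finset.mul_sum, ← Finset.sum_sub_distrib]
    exact Finset.sum_congr rfl fun i _ => by ring
  have hnorm (a : ℝ) : ∑ γ, (a * y γ - b γ) * (a * y γ - b γ)
      = a ^ 2 * ∑ i, y i ^ 2 - 2 * a * ∑ i, b i * y i + E ^ 2 := by
    rw [Finset.mul_sum, Finset.mul_sum, ← hb, ← Finset.sum_sub_distrib, ← Finset.sum_add_distrib]
    exact Finset.sum_congr rfl fun i _ => by ring
  have hrad (a : ℝ) : ∑ α, ∑ β, y α * y β * ((a * y α - b α) * (a * y β - b β))
      = (a * ∑ i, y i ^ 2 - ∑ i, b i * y i) ^ 2 := by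
    rw [← hgrad, sq, ← sum_sum_mul_mul]
    exact Finset.sum_congr rfl fun i _ => Finset.sum_congr rfl fun j _ => by ring
  have hlap (a A B : ℝ) : ∑ α, ∑ β, hinvmet n y α β * (A * ((a * y α - b α) * (a * y β - b β))
        + B * (a * hmet n y α β))
      = A * (a ^ 2 * ∑ i, y i ^ 2 - 2 * a * ∑ i, b i * y i + E ^ 2
          + (a * ∑ i, y i ^ 2 - ∑ i, b i * y i) ^ 2) + B * (a * n) := by
    rw [← trace_hmet y, ← hnorm, ← hrad,
      ← sum_sum_hinvmet_mul y fun α β => (a * y α - b α) * (a * y β - b β)]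
    simp only [Finset.mul_sum, ← Finset.sum_add_distrib]
    exact Finset.sum_congr rfl fun i _ => Finset.sum_congr rfl fun j _ => by ring
  have hfirst (a A : ℝ) : ∑ γ, y γ * (A * (a * y γ - b γ))
      = A * (a * ∑ i, y i ^ 2 - ∑ i, b i * y i) := by
    rw [← hgrad, Finset.mul_sum]
    exact Finset.sum_congr rfl fun i _ => by ring
  simp only [pdv_pdv_pairing_rpow hu, pdv_pairing_rpow (hu y)]
  refine (congrArg₂ (fun x x' : ℝ => x + n * x') (hlap _ _ _) (hfirst _ _)).trans ?_
  rw [hpow1, hpow0]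
  generalize pairing E b y ^ (-(n : ℝ) - 2) = U
  rw [pairing]
  generalize √(1 + ∑ i, y i ^ 2) = s at *
  rw [eq_sub_of_add_eq' hsq.symm]
  field_simp
  ring

theorem sum_snoc_sq (m : ℕ) (z : Fin m → ℝ) :
    ∑ i, (Fin.snoc (fun i => 2 * z i) (1 - ∑ i, z i ^ 2) : Fin (m + 1) → ℝ) i ^ 2
      = (1 + ∑ i, z i ^ 2) ^ 2 := by
  simp only [Fin.sum_univ_castSucc, Fin.snoc_castSucc, Fin.snoc_last, mul_pow, ← Finset.mul_sum]
  ring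

theorem neg_minkowski_hyp_cone (m : ℕ) (y : Fin (m + 1) → ℝ) (z : Fin m → ℝ) :
    -(minkowski (m + 1) (hyp (m + 1) y) (cone m z))
      = pairing (1 + ∑ i, z i ^ 2) (Fin.snoc (fun i => 2 * z i) (1 - ∑ i, z i ^ 2)) y := by
  simp only [minkowski, hyp, cone, pairing, Fin.cons_zero, Fin.cons_succ, neg_add, neg_neg,
    sub_eq_add_neg]
  congr 2
  exact Finset.sum_congr rfl fun i _ => mul_comm _ _

theorem contDiff_pairing_rpow (m : ℕ) (p : ℝ) :
    ContDiff ℝ (⊤ : ℕ∞) (Function.uncurry fun (y : Fin (m + 1) → ℝ) (z : Fin m → ℝ) =>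
      pairing (1 + ∑ i, z i ^ 2) (Fin.snoc (fun i => 2 * z i) (1 - ∑ i, z i ^ 2)) y ^ p) := by
  have hpos (q : (Fin (m + 1) → ℝ) × (Fin m → ℝ)) :=
    (pairing_pos (one_add_sum_sq_pos q.2) (sum_snoc_sq m q.2) q.1).ne'
  refine ContDiff.rpow_const_of_ne ?_ hpos
  simp only [pairing, Fin.sum_univ_castSucc, Fin.snoc_castSucc, Fin.snoc_last]
  refine ContDiff.sub (ContDiff.mul (ContDiff.sqrt (by fun_prop) fun q => ?_) (by fun_prop))
    (by fun_prop)
  rw [← Fin.sum_univ_castSucc (fun i => q.1 i ^ 2)]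
  exact (one_add_sum_sq_pos q.1).ne'

/-- The bulk-to-boundary propagator `ω(y) = ∫ ξ(z) (-η(P̃(y),Q̃(z)))^{-n} dz` defines a
smooth function on hyperbolic space `Hⁿ` (`n = m+1`) satisfying the SPI-supertranslation
equation `(D² + ν₀n)ω = 0` with `ν₀ = -1`, i.e. `h^{αβ}D_αD_βω = nω`.  This realises the
embedding of BMS supertranslations into SPI supertranslations. -/
theorem bms_to_spi_propagator
    (m : ℕ) (hm : 1 ≤ m)
    (ξ : (Fin m → ℝ) → ℝ) (hξc : Continuous ξ) (hξs : HasCompactSupport ξ)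
    (ω : (Fin (m+1) → ℝ) → ℝ)
    (hω : ∀ y, ω y = ∫ z : Fin m → ℝ,
      ξ z * (-(minkowski (m+1) (hyp (m+1) y) (cone m z))) ^ (-((m : ℝ) + 1))) :
    ContDiff ℝ (⊤ : ℕ∞) ω ∧
    ∀ y : Fin (m+1) → ℝ,
      ∑ α : Fin (m+1), ∑ β : Fin (m+1),
        hinvmet (m+1) y α β *
          (pdv α (pdv β ω) y - ∑ γ, Chr (m+1) y γ α β * pdv γ ω y)
        = ((m : ℝ) + 1) * ω y := by
  have hn : (m : ℝ) + 1 = ((m + 1 : ℕ) : ℝ) := by push_cast; rfl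
  have hF := contDiff_pairing_rpow m (-((m + 1 : ℕ) : ℝ))
  set F : (Fin (m + 1) → ℝ) → (Fin m → ℝ) → ℝ := fun y z =>
    pairing (1 + ∑ i, z i ^ 2) (Fin.snoc (fun i => 2 * z i) (1 - ∑ i, z i ^ 2)) y
      ^ (-((m + 1 : ℕ) : ℝ)) with hFdef
  obtain rfl : ω = fun y => ∫ z, ξ z * F y z :=
    funext fun y => by simp only [hω, neg_minkowski_hyp_cone, hn, hFdef]
  have hF1 (β : Fin (m + 1)) := contDiff_uncurry_fderiv_apply hF (Pi.single β 1)
  have hF2 (α β : Fin (m + 1)) := contDiff_uncurry_fderiv_apply (hF1 β) (Pi.single α 1)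
  have hd1 (β : Fin (m + 1)) : pdv β (fun y => ∫ z, ξ z * F y z)
      = fun y => ∫ z, ξ z * pdv β (fun y => F y z) y :=
    funext fun y => fderiv_integral_weight_mul_apply hξc hξs (hF.of_le (by simp)) y _
  have hd2 (y : Fin (m + 1) → ℝ) (α β : Fin (m + 1)) :
      pdv α (pdv β (fun y => ∫ z, ξ z * F y z)) y
        = ∫ z, ξ z * pdv α (pdv β (fun y => F y z)) y := by
    rw [hd1]
    exact fderiv_integral_weight_mul_apply hξc hξs ((hF1 β).of_le (by simp)) y _
  have hint {G : (Fin (m + 1) → ℝ) → (Fin m → ℝ) → ℝ}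
      (hG : ContDiff ℝ (⊤ : ℕ∞) (Function.uncurry G)) (y : Fin (m + 1) → ℝ) :
      Integrable fun z => ξ z * G y z :=
    (hξc.mul (hG.continuous.comp (Continuous.prodMk_right y))).integrable_of_hasCompactSupport
      hξs.mul_right
  refine ⟨contDiff_integral_weight_mul hξc hξs hF, fun y => ?_⟩
  have hi1 (γ : Fin (m + 1)) : Integrable fun z => ξ z * pdv γ (fun y => F y z) y :=
    hint (hF1 γ) y
  have hi2 (α β : Fin (m + 1)) : Integrable fun z => ξ z * pdv α (pdv β (fun y => F y z)) y :=
    hint (hF2 α β) y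
  rw [laplacian_eq, hn]
  simp only [hd2]
  simp only [hd1, ← integral_const_mul]
  simp only [← integral_finsetSum _ fun γ (_ : γ ∈ Finset.univ) => (hi1 γ).const_mul (y γ)]
  simp only [← integral_finsetSum _ fun β (_ : β ∈ Finset.univ) =>
    (hi2 _ β).const_mul (hinvmet (m + 1) y _ β)]
  rw [← integral_finsetSum _ fun α _ => integrable_finsetSum _ fun β _ =>
      (hi2 α β).const_mul (hinvmet (m + 1) y α β), ← integral_const_mul,
    ← integral_add (integrable_finsetSum _ fun α _ => integrable_finsetSum _ fun β _ =>
      (hi2 α β).const_mul (hinvmet (m + 1) y α β))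
      ((integrable_finsetSum _ fun γ _ => (hi1 γ).const_mul (y γ)).const_mul _)]
  refine integral_congr_ae (.of_forall fun z => ?_)
  have h := laplacian_pairing_rpow (one_add_sum_sq_pos z) (sum_snoc_sq m z) y
  change _ = _ * (ξ z * F y z)
  rw [mul_left_comm, ← h, mul_add, mul_left_comm (ξ z)]
  simp only [Finset.mul_sum, mul_left_comm (ξ z), hFdef]
end
end
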